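/- Let a, b, c be complex numbers with Re((1+a)/2 − b − c) > 0, such that 1+a−b and a−c are not nonpositive integers, and such that none of the arguments occurring in the Gamma functions on the right-hand side below is a nonpositive integer. Then ∑_{k=0}^∞ (a)_k (b)_k (c)_k / ( (1)_k (1+a−b)_k (a−c)_k ) = 2^{−(1+c)} · Γ(1+a−b)·Γ((1+a)/2−b−c)·Γ((a−c)/2)·Γ((1+a−c)/2) / ( Γ(1+a−b−c)·Γ(a/2)·Γ((1+a)/2−b)·Γ((1+a)/2−c) ) + 2^{−(1+c)} · Γ(1+a−b)·Γ((2+a)/2−b−c)·Γ((a−c)/2)·Γ((1+a−c)/2) / ( Γ(1+a−b−c)·Γ((1+a)/2)·Γ((2+a)/2−b)·Γ(a/2−c) ). -/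

import Mathlib

open Polynomial

section ContiguousDixon

open Filter Topology Asymptotics Finset

/-- The quotient `(x)_k / (y)_k` of two Pochhammer symbols. -/
noncomputable def pochRatio (x y : ℂ) (k : ℕ) : ℂ :=
  ∏ j ∈ range k, (x + j) / (y + j)

theorem pochRatio_zero (x y : ℂ) : pochRatio x y 0 = 1 := by simp [pochRatio]

theorem pochRatio_succ (x y : ℂ) (k : ℕ) :
    pochRatio x y (k + 1) = pochRatio x y k * ((x + k) / (y + k)) :=
  prod_range_succ _ _

theorem add_natCast_ne_zero {x : ℂ} (h : ∀ m : ℕ, x ≠ -(m : ℂ)) (k : ℕ) : x + k ≠ 0 :=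
  fun h0 => h k (eq_neg_of_add_eq_zero_left h0)

theorem add_natCast_ne_neg {x : ℂ} (h : ∀ m : ℕ, x ≠ -(m : ℂ)) (n m : ℕ) :
    x + n ≠ -(m : ℂ) := fun h0 => h (n + m) (by push_cast; linear_combination h0)

theorem ascPochhammer_eval_eq_prod (x : ℂ) (k : ℕ) :
    (ascPochhammer ℂ k).eval x = ∏ j ∈ range k, (x + j) := by
  induction k with
  | zero => simp
  | succ k ih => rw [ascPochhammer_succ_eval, prod_range_succ, ih]

theorem pochRatio_eq_div (x y : ℂ) (k : ℕ) :
    pochRatio x y k = (ascPochhammer ℂ k).eval x / (ascPochhammer ℂ k).eval y := by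
  simp [pochRatio, prod_div_distrib, ascPochhammer_eval_eq_prod]

theorem ascPochhammer_eval_ne_zero {x : ℂ} (h : ∀ m : ℕ, x ≠ -(m : ℂ)) (k : ℕ) :
    (ascPochhammer ℂ k).eval x ≠ 0 := by
  rw [ascPochhammer_eval_eq_prod]
  exact prod_ne_zero_iff.2 fun j _ => add_natCast_ne_zero h j

theorem mul_ascPochhammer_eval_add_one (x : ℂ) (k : ℕ) :
    x * (ascPochhammer ℂ k).eval (x + 1) = (ascPochhammer ℂ k).eval x * (x + k) := by
  rw [← ascPochhammer_succ_eval, ascPochhammer_succ_left]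
  simp

theorem pochRatio_add_one_right {x : ℂ} (h : ∀ m : ℕ, x ≠ -(m : ℂ)) (k : ℕ) :
    pochRatio x (x + 1) k = x / (x + k) := by
  have h1 := mul_ascPochhammer_eval_add_one x k
  have h2 : (ascPochhammer ℂ k).eval (x + 1) ≠ 0 :=
    ascPochhammer_eval_ne_zero (by simpa using add_natCast_ne_neg h 1) k
  rw [pochRatio_eq_div, div_eq_div_iff h2 (add_natCast_ne_zero h k), h1]

/-- Euler's product for the Gamma function, in the form of an asymptotic for `(x)_n / (y)_n`. -/
theorem tendsto_pochRatio_mul_cpow (x : ℂ) {y : ℂ} (hy : ∀ m : ℕ, y ≠ -(m : ℂ)) :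
    Tendsto (fun n : ℕ => pochRatio x y (n + 1) * (n : ℂ) ^ (y - x)) atTop
      (𝓝 (Complex.Gamma y / Complex.Gamma x)) := by
  by_cases hx : ∃ m : ℕ, x = -(m : ℂ)
  · have h0 := (Complex.Gamma_eq_zero_iff x).2 hx
    obtain ⟨m, rfl⟩ := hx
    rw [h0, div_zero]
    refine tendsto_const_nhds.congr' ?_
    filter_upwards [eventually_ge_atTop m] with n hn
    have : pochRatio (-(m : ℂ)) y (n + 1) = 0 :=
      prod_eq_zero (i := m) (by simp; omega) (by simp)
    simp [this]
  · push Not at hx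
    refine ((Complex.GammaSeq_tendsto_Gamma y).div (Complex.GammaSeq_tendsto_Gamma x)
      (Complex.Gamma_ne_zero hx)).congr' ?_
    filter_upwards [eventually_ge_atTop 1] with n hn
    have hn0 : (n : ℂ) ≠ 0 := by exact_mod_cast (by omega : n ≠ 0)
    have h1 : (∏ j ∈ range (n + 1), (x + j)) ≠ 0 :=
      prod_ne_zero_iff.2 fun j _ => add_natCast_ne_zero hx j
    have h2 : (∏ j ∈ range (n + 1), (y + j)) ≠ 0 :=
      prod_ne_zero_iff.2 fun j _ => add_natCast_ne_zero hy j
    have h3 : (n : ℂ) ^ x ≠ 0 := by simp [Complex.cpow_eq_zero_iff, hn0]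
    have h4 : (n.factorial : ℂ) ≠ 0 := by exact_mod_cast n.factorial_ne_zero
    simp only [Pi.div_apply, Complex.GammaSeq, pochRatio, prod_div_distrib]
    rw [Complex.cpow_sub _ _ hn0]
    field_simp

theorem pochRatio_isBigO (x : ℂ) {y : ℂ} (hy : ∀ m : ℕ, y ≠ -(m : ℂ)) :
    (fun n : ℕ => pochRatio x y (n + 1)) =O[atTop] fun n : ℕ => (n : ℝ) ^ (x - y).re := by
  have h := (tendsto_pochRatio_mul_cpow x hy).isBigO_one ℝ
  have h2 : (fun n : ℕ => (n : ℂ) ^ (x - y)) =O[atTop] fun n : ℕ => (n : ℝ) ^ (x - y).re := by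
    refine IsBigO.of_bound 1 ?_
    filter_upwards [eventually_ge_atTop 1] with n hn
    rw [Complex.norm_natCast_cpow_of_pos hn, one_mul]
    exact le_abs_self _
  refine ((h.mul h2).congr' ?_ ?_)
  · filter_upwards [eventually_ge_atTop 1] with n hn
    have hn0 : (n : ℂ) ≠ 0 := by exact_mod_cast (by omega : n ≠ 0)
    rw [mul_assoc, ← Complex.cpow_add _ _ hn0]
    simp
  · simp

section FourRatios

variable {x₁ x₂ x₃ x₄ y₁ y₂ y₃ y₄ : ℂ}

theorem pochRatio_four_isBigO (h₁ : ∀ m : ℕ, y₁ ≠ -(m : ℂ)) (h₂ : ∀ m : ℕ, y₂ ≠ -(m : ℂ))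
    (h₃ : ∀ m : ℕ, y₃ ≠ -(m : ℂ)) (h₄ : ∀ m : ℕ, y₄ ≠ -(m : ℂ)) :
    (fun n : ℕ => pochRatio x₁ y₁ (n + 1) * pochRatio x₂ y₂ (n + 1) *
      pochRatio x₃ y₃ (n + 1) * pochRatio x₄ y₄ (n + 1)) =O[atTop]
      fun n : ℕ => (n : ℝ) ^ (x₁ + x₂ + x₃ + x₄ - y₁ - y₂ - y₃ - y₄).re := by
  refine ((((pochRatio_isBigO x₁ h₁).mul (pochRatio_isBigO x₂ h₂)).mul
    (pochRatio_isBigO x₃ h₃)).mul (pochRatio_isBigO x₄ h₄)).congr' (Eventually.of_forall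
    fun n => rfl) ?_
  filter_upwards [eventually_ge_atTop 1] with n hn
  have hn0 : (0 : ℝ) < n := by exact_mod_cast hn
  rw [← Real.rpow_add hn0, ← Real.rpow_add hn0, ← Real.rpow_add hn0]
  congr 1
  simp
  ring

theorem summable_mul_norm_pochRatio_four (h₁ : ∀ m : ℕ, y₁ ≠ -(m : ℂ))
    (h₂ : ∀ m : ℕ, y₂ ≠ -(m : ℂ)) (h₃ : ∀ m : ℕ, y₃ ≠ -(m : ℂ)) (h₄ : ∀ m : ℕ, y₄ ≠ -(m : ℂ))
    (hs : (x₁ + x₂ + x₃ + x₄ - y₁ - y₂ - y₃ - y₄).re < -2) (C : ℝ) :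
    Summable fun k : ℕ => (1 + C * k) * ‖pochRatio x₁ y₁ k * pochRatio x₂ y₂ k *
      pochRatio x₃ y₃ k * pochRatio x₄ y₄ k‖ := by
  rw [← summable_nat_add_iff 1]
  set s := (x₁ + x₂ + x₃ + x₄ - y₁ - y₂ - y₃ - y₄).re
  have hO : (fun n : ℕ => (1 + C * ((n + 1 : ℕ) : ℝ))) =O[atTop] fun n : ℕ => (n : ℝ) := by
    refine IsBigO.of_bound (1 + 2 * |C|) ?_
    filter_upwards [eventually_ge_atTop 1] with n hn
    have hn1 : (1 : ℝ) ≤ n := by exact_mod_cast hn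
    rw [Real.norm_eq_abs, Real.norm_eq_abs, abs_of_nonneg (by positivity : (0 : ℝ) ≤ n)]
    refine (abs_add_le _ _).trans ?_
    rw [abs_mul, abs_one, abs_of_nonneg (by positivity : (0 : ℝ) ≤ ((n + 1 : ℕ) : ℝ))]
    push_cast
    nlinarith [abs_nonneg C]
  refine summable_of_isBigO_nat (Real.summable_nat_rpow.2 (by linarith : s + 1 < -1)) ?_
  refine (hO.mul (pochRatio_four_isBigO h₁ h₂ h₃ h₄).norm_left).congr' (Eventually.of_forall
    fun n => rfl) ?_
  filter_upwards [eventually_ge_atTop 1] with n hn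
  have hn0 : (0 : ℝ) < n := by exact_mod_cast hn
  rw [Real.rpow_add hn0, Real.rpow_one, mul_comm]

theorem tendsto_quadratic_mul_pochRatio_four (h₁ : ∀ m : ℕ, y₁ ≠ -(m : ℂ))
    (h₂ : ∀ m : ℕ, y₂ ≠ -(m : ℂ)) (h₃ : ∀ m : ℕ, y₃ ≠ -(m : ℂ)) (h₄ : ∀ m : ℕ, y₄ ≠ -(m : ℂ))
    (hs : (x₁ + x₂ + x₃ + x₄ - y₁ - y₂ - y₃ - y₄).re < -2) (e : ℂ) :
    Tendsto (fun k : ℕ => (k : ℂ) * (k + e) * (pochRatio x₁ y₁ k * pochRatio x₂ y₂ k *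
      pochRatio x₃ y₃ k * pochRatio x₄ y₄ k)) atTop (𝓝 0) := by
  rw [← tendsto_add_atTop_iff_nat 1]
  set s := (x₁ + x₂ + x₃ + x₄ - y₁ - y₂ - y₃ - y₄).re
  have hO : ∀ e : ℂ, (fun n : ℕ => (((n + 1 : ℕ) : ℂ) + e)) =O[atTop] fun n : ℕ => (n : ℝ) := by
    intro e
    refine IsBigO.of_bound (2 + ‖e‖) ?_
    filter_upwards [eventually_ge_atTop 1] with n hn
    have hn1 : (1 : ℝ) ≤ n := by exact_mod_cast hn
    rw [Real.norm_eq_abs, abs_of_nonneg (by positivity : (0 : ℝ) ≤ n)]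
    refine (norm_add_le _ _).trans ?_
    rw [Complex.norm_natCast]
    push_cast
    nlinarith [norm_nonneg e]
  have key := ((hO 0).mul (hO e)).mul (pochRatio_four_isBigO (x₁ := x₁) (x₂ := x₂) (x₃ := x₃)
    (x₄ := x₄) h₁ h₂ h₃ h₄)
  have hlim : Tendsto (fun n : ℕ => (n : ℝ) * n * (n : ℝ) ^ s) atTop (𝓝 0) := by
    have := (tendsto_rpow_neg_atTop (by linarith : 0 < -(s + 2))).comp
      (tendsto_natCast_atTop_atTop (R := ℝ))
    refine this.congr' ?_
    filter_upwards [eventually_ge_atTop 1] with n hn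
    have hn0 : (0 : ℝ) < n := by exact_mod_cast hn
    simp only [Function.comp]
    rw [neg_neg, Real.rpow_add hn0, Real.rpow_two]
    ring
  refine (key.trans_tendsto hlim).congr fun n => ?_
  simp

end FourRatios

/-- The ratio of Pochhammer symbols in a well-poised series without its very-well-poised factor. -/
noncomputable def wellPoised (a b c d : ℂ) (k : ℕ) : ℂ :=
  pochRatio a (1 + a - b) k * pochRatio b (1 + a - c) k * pochRatio c (1 + a - d) k *
    pochRatio d 1 k

/-- The general term of the very-well-poised `₅F₄` series at `1`. -/
noncomputable def veryWellPoised (a b c d : ℂ) (k : ℕ) : ℂ :=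
  (1 + 2 * k / a) * wellPoised a b c d k

theorem one_ne_neg_natCast (m : ℕ) : (1 : ℂ) ≠ -(m : ℂ) := by
  intro h
  have h1 : ((1 + m : ℕ) : ℂ) = 0 := by push_cast; linear_combination h
  rw [Nat.cast_eq_zero] at h1
  omega

theorem ne_neg_natCast_of_re_pos {x : ℂ} (h : 0 < x.re) (m : ℕ) : x ≠ -(m : ℂ) := by
  rintro rfl
  simp at h
  linarith [(Nat.cast_nonneg m : (0 : ℝ) ≤ m)]

section Summation

variable {a b c d : ℂ}

theorem wellPoised_exponent_lt (hs : 0 < (1 + a - b - c - d).re) :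
    (a + b + c + d - (1 + a - b) - (1 + a - c) - (1 + a - d) - 1).re < -2 := by
  simp at hs ⊢
  linarith

theorem summable_veryWellPoised (hs : 0 < (1 + a - b - c - d).re)
    (hb : ∀ m : ℕ, 1 + a - b ≠ -(m : ℂ)) (hc : ∀ m : ℕ, 1 + a - c ≠ -(m : ℂ))
    (hd : ∀ m : ℕ, 1 + a - d ≠ -(m : ℂ)) : Summable (veryWellPoised a b c d) := by
  refine Summable.of_norm_bounded (summable_mul_norm_pochRatio_four hb hc hd one_ne_neg_natCast
    (wellPoised_exponent_lt hs) (2 / ‖a‖)) fun k => ?_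
  rw [veryWellPoised, norm_mul, wellPoised]
  gcongr
  refine (norm_add_le _ _).trans (le_of_eq ?_)
  simp
  ring

theorem wellPoised_add_one (ha : ∀ m : ℕ, a ≠ -(m : ℂ))
    (hb : ∀ m : ℕ, 1 + a - b ≠ -(m : ℂ)) (hc : ∀ m : ℕ, 1 + a - c ≠ -(m : ℂ))
    (hd : ∀ m : ℕ, 1 + a - d ≠ -(m : ℂ)) (k : ℕ) :
    wellPoised (a + 1) b c d k = wellPoised a b c d k * ((a + k) / a *
      ((1 + a - b) / (1 + a - b + k)) * ((1 + a - c) / (1 + a - c + k)) *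
      ((1 + a - d) / (1 + a - d + k))) := by
  have h0 : a ≠ 0 := by simpa using ha 0
  have key : ∀ x : ℂ, (∀ m : ℕ, 1 + a - x ≠ -(m : ℂ)) →
      (ascPochhammer ℂ k).eval (1 + (a + 1) - x) ≠ 0 ∧ (ascPochhammer ℂ k).eval (1 + a - x) =
        (ascPochhammer ℂ k).eval (1 + (a + 1) - x) * ((1 + a - x) / (1 + a - x + k)) := by
    intro x hx
    have e : 1 + (a + 1) - x = (1 + a - x) + 1 := by ring
    refine ⟨ascPochhammer_eval_ne_zero (by
      rw [e]; simpa using add_natCast_ne_neg hx 1) k, ?_⟩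
    rw [e, mul_div_assoc', eq_div_iff (add_natCast_ne_zero hx k),
      ← mul_ascPochhammer_eval_add_one, mul_comm]
  have ea : (ascPochhammer ℂ k).eval (a + 1) = (ascPochhammer ℂ k).eval a * ((a + k) / a) := by
    rw [mul_div_assoc', eq_div_iff h0, ← mul_ascPochhammer_eval_add_one, mul_comm]
  have n1 := ascPochhammer_eval_ne_zero one_ne_neg_natCast k
  have fb := by simpa using hb 0
  have fc := by simpa using hc 0
  have fd := by simpa using hd 0
  have gb := add_natCast_ne_zero hb k
  have gc := add_natCast_ne_zero hc k
  have gd := add_natCast_ne_zero hd k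
  obtain ⟨nb, eb⟩ := key b hb
  obtain ⟨nc, ec⟩ := key c hc
  obtain ⟨nd, ed⟩ := key d hd
  simp only [wellPoised, pochRatio_eq_div]
  rw [eb, ec, ed, ea]
  field_simp

theorem wellPoised_succ (k : ℕ) :
    wellPoised a b c d (k + 1) = wellPoised a b c d k * ((a + k) * (b + k) * (c + k) * (d + k) /
      ((1 + a - b + k) * (1 + a - c + k) * (1 + a - d + k) * (1 + k))) := by
  simp only [wellPoised, pochRatio_succ]
  simp only [div_eq_mul_inv, mul_inv]
  ring

theorem veryWellPoised_telescope (ha : ∀ m : ℕ, a ≠ -(m : ℂ))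
    (hb : ∀ m : ℕ, 1 + a - b ≠ -(m : ℂ)) (hc : ∀ m : ℕ, 1 + a - c ≠ -(m : ℂ))
    (hd : ∀ m : ℕ, 1 + a - d ≠ -(m : ℂ)) (k : ℕ) :
    (1 + a - b - c - d) * veryWellPoised a b c d k -
      (1 + a) * (1 + a - b - c) * (1 + a - b - d) * (1 + a - c - d) /
        ((1 + a - b) * (1 + a - c) * (1 + a - d)) * veryWellPoised (a + 1) b c d k =
    -(1 / a) * ((((k + 1 : ℕ) : ℂ) * ((k + 1 : ℕ) + (1 + 2 * a - b - c - d)) *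
        wellPoised a b c d (k + 1)) -
      k * (k + (1 + 2 * a - b - c - d)) * wellPoised a b c d k) := by
  have h0 : a ≠ 0 := by simpa using ha 0
  have h1 : a + 1 ≠ 0 := by simpa using add_natCast_ne_zero ha 1
  have fb := by simpa using hb 0
  have fc := by simpa using hc 0
  have fd := by simpa using hd 0
  have gb := add_natCast_ne_zero hb k
  have gc := add_natCast_ne_zero hc k
  have gd := add_natCast_ne_zero hd k
  have g1 := add_natCast_ne_zero one_ne_neg_natCast k
  rw [veryWellPoised, veryWellPoised, wellPoised_succ, wellPoised_add_one ha hb hc hd]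
  generalize wellPoised a b c d k = v
  push_cast
  generalize (k : ℂ) = x at *
  have : v * ((1 + a - b - c - d) * (1 + 2 * x / a) -
      (1 + a) * (1 + a - b - c) * (1 + a - b - d) * (1 + a - c - d) /
        ((1 + a - b) * (1 + a - c) * (1 + a - d)) * ((1 + 2 * x / (a + 1)) * ((a + x) / a *
      ((1 + a - b) / (1 + a - b + x)) * ((1 + a - c) / (1 + a - c + x)) *
      ((1 + a - d) / (1 + a - d + x))))) =
    v * (-(1 / a) * (((x + 1) * (x + 1 + (1 + 2 * a - b - c - d)) *
        ((a + x) * (b + x) * (c + x) * (d + x) /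
      ((1 + a - b + x) * (1 + a - c + x) * (1 + a - d + x) * (1 + x)))) -
      x * (x + (1 + 2 * a - b - c - d)))) := by
    congr 1
    field_simp
    ring
  linear_combination this

theorem tsum_veryWellPoised_add_one (hs : 0 < (1 + a - b - c - d).re)
    (ha : ∀ m : ℕ, a ≠ -(m : ℂ))
    (hb : ∀ m : ℕ, 1 + a - b ≠ -(m : ℂ)) (hc : ∀ m : ℕ, 1 + a - c ≠ -(m : ℂ))
    (hd : ∀ m : ℕ, 1 + a - d ≠ -(m : ℂ)) :
    ∑' k, veryWellPoised a b c d k =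
      (1 + a) * (1 + a - b - c) * (1 + a - b - d) * (1 + a - c - d) /
        ((1 + a - b) * (1 + a - c) * (1 + a - d) * (1 + a - b - c - d)) *
        ∑' k, veryWellPoised (a + 1) b c d k := by
  have shift : ∀ x : ℂ, (∀ m : ℕ, 1 + a - x ≠ -(m : ℂ)) → ∀ m : ℕ, 1 + (a + 1) - x ≠ -(m : ℂ) := by
    intro x hx m
    have := add_natCast_ne_neg hx 1 m
    rwa [show 1 + (a + 1) - x = 1 + a - x + (1 : ℕ) by push_cast; ring]
  have S1 := summable_veryWellPoised hs hb hc hd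
  have S2 : Summable (veryWellPoised (a + 1) b c d) :=
    summable_veryWellPoised (by simp at hs ⊢; linarith) (shift b hb) (shift c hc) (shift d hd)
  have hσ : 1 + a - b - c - d ≠ 0 := by simpa using ne_neg_natCast_of_re_pos hs 0
  set K := (1 + a) * (1 + a - b - c) * (1 + a - b - d) * (1 + a - c - d) /
        ((1 + a - b) * (1 + a - c) * (1 + a - d)) with hK
  have hsum := (S1.hasSum.mul_left (1 + a - b - c - d)).sub (S2.hasSum.mul_left K)
  have hT := hsum.tendsto_sum_nat
  have hG : Tendsto (fun n : ℕ => ∑ k ∈ range n, ((1 + a - b - c - d) * veryWellPoised a b c d k -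
      K * veryWellPoised (a + 1) b c d k)) atTop (𝓝 0) := by
    have hq := (tendsto_quadratic_mul_pochRatio_four (x₁ := a) (x₂ := b) (x₃ := c) (x₄ := d)
      hb hc hd one_ne_neg_natCast (wellPoised_exponent_lt hs) (1 + 2 * a - b - c - d)).const_mul
      (-(1 / a))
    rw [mul_zero] at hq
    refine hq.congr fun n => ?_
    simp only [hK, veryWellPoised_telescope ha hb hc hd]
    rw [← mul_sum, sum_range_sub (fun k : ℕ => (k : ℂ) * (k + (1 + 2 * a - b - c - d)) *
      wellPoised a b c d k)]
    simp [wellPoised]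
  have h := tendsto_nhds_unique hT hG
  have h' : (1 + a - b - c - d) * ∑' k, veryWellPoised a b c d k =
      K * ∑' k, veryWellPoised (a + 1) b c d k := sub_eq_zero.1 h
  rw [div_mul_eq_div_div, ← hK, div_mul_eq_mul_div, eq_div_iff hσ, ← h', mul_comm]

theorem tsum_veryWellPoised_add_natCast (hs : 0 < (1 + a - b - c - d).re)
    (ha : ∀ m : ℕ, a ≠ -(m : ℂ))
    (hb : ∀ m : ℕ, 1 + a - b ≠ -(m : ℂ)) (hc : ∀ m : ℕ, 1 + a - c ≠ -(m : ℂ))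
    (hd : ∀ m : ℕ, 1 + a - d ≠ -(m : ℂ)) (n : ℕ) :
    ∑' k, veryWellPoised a b c d k =
      pochRatio (1 + a) (1 + a - b) n * pochRatio (1 + a - b - c) (1 + a - c) n *
      pochRatio (1 + a - b - d) (1 + a - d) n * pochRatio (1 + a - c - d) (1 + a - b - c - d) n *
        ∑' k, veryWellPoised (a + n) b c d k := by
  induction n with
  | zero => simp [pochRatio_zero]
  | succ n ih =>
    have shift : ∀ x : ℂ, (∀ m : ℕ, 1 + a - x ≠ -(m : ℂ)) →
        ∀ m : ℕ, 1 + (a + n) - x ≠ -(m : ℂ) := by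
      intro x hx m
      have := add_natCast_ne_neg hx n m
      rwa [show 1 + (a + n) - x = 1 + a - x + n by ring]
    rw [ih, tsum_veryWellPoised_add_one (a := a + n) ?_ (add_natCast_ne_neg ha n) (shift b hb)
      (shift c hc) (shift d hd)]
    · simp only [pochRatio_succ]
      rw [show a + (n : ℂ) + 1 = a + (n + 1 : ℕ) by push_cast; ring]
      generalize ∑' k, veryWellPoised (a + (n + 1 : ℕ)) b c d k = T
      simp only [add_sub_right_comm, ← add_assoc, div_eq_mul_inv, mul_inv]
      ring
    · simp at hs ⊢
      linarith [(Nat.cast_nonneg n : (0 : ℝ) ≤ n)]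

theorem norm_pochRatio_le {x y : ℂ} {p q : ℕ}
    (h : ∀ j : ℕ, ‖(x + j) / (y + j)‖ ≤ ((p : ℝ) + j) / (q + j)) (k : ℕ) :
    ‖pochRatio x y k‖ ≤ ‖pochRatio p q k‖ := by
  rw [pochRatio, pochRatio, norm_prod, norm_prod]
  refine prod_le_prod (fun _ _ => norm_nonneg _) fun j _ => (h j).trans (le_of_eq ?_)
  rw [norm_div]
  norm_cast

theorem norm_veryWellPoised_le {M n : ℕ} (hM : 1 ≤ M) (ha : ‖a‖ ≤ M) (hb : ‖b‖ ≤ M) (hc : ‖c‖ ≤ M)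
    (hd : ‖d‖ ≤ M) (hn : 5 * M ≤ n) (k : ℕ) :
    ‖veryWellPoised (a + n) b c d k‖ ≤
      (1 + 2 * k) * ‖pochRatio (6 * M : ℕ) (3 * M + 1 : ℕ) k * pochRatio M (3 * M + 1 : ℕ) k *
        pochRatio M (3 * M + 1 : ℕ) k * pochRatio M (1 : ℕ) k‖ := by
  have hM' : (1 : ℝ) ≤ M := by exact_mod_cast hM
  have hn' : 5 * (M : ℝ) ≤ n := by exact_mod_cast hn
  have lower : ∀ x : ℂ, ‖x‖ ≤ M → ∀ j : ℕ,
      (n : ℝ) + 1 - 2 * M + j ≤ ‖1 + (a + n) - x + j‖ := by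
    intro x hx j
    have h1 : ‖((n + 1 + j : ℕ) : ℂ)‖ ≤ ‖1 + (a + n) - x + j‖ + ‖x - a‖ := by
      refine le_trans (le_of_eq ?_) (norm_add_le _ _)
      congr 1
      push_cast
      ring
    rw [Complex.norm_natCast] at h1
    push_cast at h1
    linarith [norm_sub_le x a]
  have upper : ∀ x : ℂ, ‖x‖ ≤ M → ∀ j : ℕ, ‖x + j‖ ≤ M + j := by
    intro x hx j
    refine (norm_add_le _ _).trans ?_
    rw [Complex.norm_natCast]
    linarith
  have mid : ∀ x y : ℂ, ‖x‖ ≤ M → ‖y‖ ≤ M → ∀ j : ℕ, ‖(x + j) / (1 + (a + n) - y + j)‖ ≤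
      ((M : ℝ) + j) / ((3 * M + 1 : ℕ) + j) := by
    intro x y hx hy j
    rw [norm_div]
    push_cast
    gcongr
    · exact upper x hx j
    · linarith [lower y hy j]
  have first : ∀ j : ℕ, ‖(a + n + j) / (1 + (a + n) - b + j)‖ ≤
      (((6 * M : ℕ) : ℝ) + j) / ((3 * M + 1 : ℕ) + j) := by
    intro j
    have hj : (0 : ℝ) ≤ j := Nat.cast_nonneg j
    have h1 : ‖a + n + j‖ ≤ n + M + j := by
      have := upper a ha (n + j)
      push_cast at this
      rw [← add_assoc] at this
      linarith
    have hpos : (0 : ℝ) < (n : ℝ) + 1 - 2 * M + j := by linarith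
    rw [norm_div]
    refine (div_le_div₀ (by positivity) h1 hpos (lower b hb j)).trans ?_
    push_cast
    rw [div_le_div_iff₀ hpos (by positivity)]
    nlinarith
  have last : ∀ j : ℕ, ‖(d + j) / (1 + j)‖ ≤ ((M : ℝ) + j) / ((1 : ℕ) + j) := by
    intro j
    have : ‖(1 : ℂ) + j‖ = 1 + j := by norm_cast
    rw [norm_div, this]
    push_cast
    gcongr
    exact upper d hd j
  have pre : ‖1 + 2 * (k : ℂ) / (a + n)‖ ≤ 1 + 2 * k := by
    refine (norm_add_le _ _).trans ?_
    have h1 : 1 ≤ ‖a + n‖ := by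
      have h2 : ‖(n : ℂ)‖ ≤ ‖a + n‖ + ‖a‖ := by
        simpa using norm_sub_le (a + n) a
      rw [Complex.norm_natCast] at h2
      linarith
    rw [norm_one, norm_div, norm_mul, Complex.norm_natCast, Complex.norm_ofNat]
    gcongr
    exact div_le_self (by positivity) h1
  rw [veryWellPoised, norm_mul, wellPoised]
  simp only [norm_mul]
  gcongr
  · exact norm_pochRatio_le first k
  · exact norm_pochRatio_le (mid b c hb hc) k
  · exact norm_pochRatio_le (mid c d hc hd) k
  · exact norm_pochRatio_le last k

theorem tendsto_add_natCast_cobounded (x : ℂ) :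
    Tendsto (fun n : ℕ => x + (n : ℂ)) atTop (Bornology.cobounded ℂ) := by
  rw [← tendsto_norm_atTop_iff_cobounded]
  refine tendsto_atTop_mono (f := fun n : ℕ => (n : ℝ) - ‖x‖) (fun n => ?_)
    (tendsto_atTop_add_const_right _ _ tendsto_natCast_atTop_atTop)
  have : ‖(n : ℂ)‖ ≤ ‖x + n‖ + ‖x‖ := by simpa using norm_sub_le (x + n) x
  rw [Complex.norm_natCast] at this
  linarith

theorem tendsto_div_add_natCast (w x : ℂ) :
    Tendsto (fun n : ℕ => w / (x + (n : ℂ))) atTop (𝓝 0) := by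
  simpa [div_eq_mul_inv] using
    (tendsto_inv₀_cobounded.comp (tendsto_add_natCast_cobounded x)).const_mul w

theorem tendsto_veryWellPoised_add_natCast (a b c d : ℂ) (k : ℕ) :
    Tendsto (fun n : ℕ => veryWellPoised (a + n) b c d k) atTop (𝓝 (if k = 0 then 1 else 0)) := by
  have hsmall : ∀ x y : ℂ,
      Tendsto (fun n : ℕ => pochRatio x (1 + (a + n) - y) k) atTop (𝓝 (0 ^ k)) := by
    intro x y
    have : Tendsto (fun n : ℕ => pochRatio x (1 + (a + n) - y) k) atTop
        (𝓝 (∏ j ∈ range k, 0)) := by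
      refine tendsto_finsetProd _ fun j _ => ?_
      refine (tendsto_div_add_natCast (x + j) (1 + a - y + j)).congr fun n => ?_
      congr 1
      ring
    simpa using this
  have hfirst : Tendsto (fun n : ℕ => pochRatio (a + n) (1 + (a + n) - b) k) atTop (𝓝 1) := by
    have : Tendsto (fun n : ℕ => pochRatio (a + n) (1 + (a + n) - b) k) atTop
        (𝓝 (∏ j ∈ range k, (1 - 0))) := by
      refine tendsto_finsetProd _ fun j _ => ?_
      refine ((tendsto_div_add_natCast (1 - b) (1 + a - b + j)).const_sub 1).congr' ?_
      filter_upwards [(tendsto_add_natCast_cobounded (1 + a - b + j)).eventually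
        (Bornology.eventually_ne_cobounded 0)] with n hn
      have hn' : 1 + (a + n) - b + j ≠ 0 := by
        convert hn using 1
        ring
      rw [eq_div_iff hn', sub_mul, show 1 + (a + n) - b + j = 1 + a - b + j + (n : ℂ) by ring,
        div_mul_cancel₀ _ hn]
      ring
    simpa using this
  have hpre : Tendsto (fun n : ℕ => 1 + 2 * (k : ℂ) / (a + n)) atTop (𝓝 (1 + 0)) :=
    (tendsto_div_add_natCast (2 * k) a).const_add 1
  have h := hpre.mul (((hfirst.mul (hsmall b c)).mul (hsmall c d)).mul_const (pochRatio d 1 k))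
  have e : (1 + 0) * (1 * 0 ^ k * 0 ^ k * pochRatio d 1 k) = if k = 0 then (1 : ℂ) else 0 := by
    rcases eq_or_ne k 0 with rfl | hk
    · simp [pochRatio_zero]
    · simp [hk]
  rw [← e]
  exact h

theorem tendsto_tsum_veryWellPoised_add_natCast (a b c d : ℂ) :
    Tendsto (fun n : ℕ => ∑' k, veryWellPoised (a + n) b c d k) atTop (𝓝 1) := by
  obtain ⟨M, hM⟩ := exists_nat_ge (1 + ‖a‖ + ‖b‖ + ‖c‖ + ‖d‖)
  have na := norm_nonneg a
  have nb := norm_nonneg b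
  have nc := norm_nonneg c
  have nd := norm_nonneg d
  have hM1 : 1 ≤ M := by exact_mod_cast (by linarith : (1 : ℝ) ≤ M)
  have hnat : ∀ q : ℕ, 0 < q → ∀ m : ℕ, ((q : ℕ) : ℂ) ≠ -(m : ℂ) := fun q hq =>
    ne_neg_natCast_of_re_pos (by simpa using hq)
  have hsum := summable_mul_norm_pochRatio_four (x₁ := (6 * M : ℕ)) (x₂ := M) (x₃ := M) (x₄ := M)
    (hnat (3 * M + 1) (by omega)) (hnat (3 * M + 1) (by omega)) (hnat (3 * M + 1) (by omega))
    (hnat 1 one_pos) (by simp; linarith) 2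
  have h := tendsto_tsum_of_dominated_convergence hsum
    (fun k => tendsto_veryWellPoised_add_natCast a b c d k) (by
      filter_upwards [eventually_ge_atTop (5 * M)] with n hn k
      exact norm_veryWellPoised_le hM1 (by linarith) (by linarith) (by linarith) (by linarith) hn k)
  simpa using h

/-- The nonterminating very-well-poised `₅F₄` summation at `1`. -/
theorem tsum_veryWellPoised (hs : 0 < (1 + a - b - c - d).re)
    (ha : ∀ m : ℕ, a ≠ -(m : ℂ))
    (hb : ∀ m : ℕ, 1 + a - b ≠ -(m : ℂ)) (hc : ∀ m : ℕ, 1 + a - c ≠ -(m : ℂ))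
    (hd : ∀ m : ℕ, 1 + a - d ≠ -(m : ℂ)) :
    ∑' k, veryWellPoised a b c d k =
      Complex.Gamma (1 + a - b) / Complex.Gamma (1 + a) *
      (Complex.Gamma (1 + a - c) / Complex.Gamma (1 + a - b - c)) *
      (Complex.Gamma (1 + a - d) / Complex.Gamma (1 + a - b - d)) *
      (Complex.Gamma (1 + a - b - c - d) / Complex.Gamma (1 + a - c - d)) := by
  have h := ((((tendsto_pochRatio_mul_cpow (1 + a) hb).mul
    (tendsto_pochRatio_mul_cpow (1 + a - b - c) hc)).mul
    (tendsto_pochRatio_mul_cpow (1 + a - b - d) hd)).mul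
    (tendsto_pochRatio_mul_cpow (1 + a - c - d) (ne_neg_natCast_of_re_pos hs))).mul
    ((tendsto_add_atTop_iff_nat 1).2 (tendsto_tsum_veryWellPoised_add_natCast a b c d))
  rw [mul_one] at h
  refine tendsto_nhds_unique (tendsto_const_nhds.congr' ?_) h
  filter_upwards [eventually_ge_atTop 1] with n hn
  have hn0 : (n : ℂ) ≠ 0 := by exact_mod_cast (by omega : n ≠ 0)
  have hpow : (n : ℂ) ^ (1 + a - b - (1 + a)) * (n : ℂ) ^ (1 + a - c - (1 + a - b - c)) *
      (n : ℂ) ^ (1 + a - d - (1 + a - b - d)) *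
      (n : ℂ) ^ (1 + a - b - c - d - (1 + a - c - d)) = 1 := by
    rw [← Complex.cpow_add _ _ hn0, ← Complex.cpow_add _ _ hn0, ← Complex.cpow_add _ _ hn0]
    ring_nf
    simp
  rw [tsum_veryWellPoised_add_natCast hs ha hb hc hd (n + 1)]
  linear_combination (-(pochRatio (1 + a) (1 + a - b) (n + 1) *
    pochRatio (1 + a - b - c) (1 + a - c) (n + 1) *
    pochRatio (1 + a - b - d) (1 + a - d) (n + 1) *
    pochRatio (1 + a - c - d) (1 + a - b - c - d) (n + 1) *
    ∑' k, veryWellPoised (a + (n + 1 : ℕ)) b c d k)) * hpow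

theorem veryWellPoised_one_add_div_two (hd : ∀ m : ℕ, (1 + a) / 2 ≠ -(m : ℂ)) (k : ℕ) :
    veryWellPoised a b c ((1 + a) / 2) k = (1 + 2 * k / a) *
      ((ascPochhammer ℂ k).eval a * (ascPochhammer ℂ k).eval b * (ascPochhammer ℂ k).eval c /
        ((ascPochhammer ℂ k).eval 1 * (ascPochhammer ℂ k).eval (1 + a - b) *
          (ascPochhammer ℂ k).eval (1 + a - c))) := by
  have h := ascPochhammer_eval_ne_zero hd k
  rw [veryWellPoised, wellPoised, show 1 + a - (1 + a) / 2 = (1 + a) / 2 by ring]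
  simp only [pochRatio_eq_div]
  field_simp

theorem veryWellPoised_div_two (ha : ∀ m : ℕ, a / 2 ≠ -(m : ℂ)) (k : ℕ) :
    veryWellPoised a b c (a / 2) k =
      (ascPochhammer ℂ k).eval a * (ascPochhammer ℂ k).eval b * (ascPochhammer ℂ k).eval c /
        ((ascPochhammer ℂ k).eval 1 * (ascPochhammer ℂ k).eval (1 + a - b) *
          (ascPochhammer ℂ k).eval (1 + a - c)) := by
  have h := pochRatio_add_one_right ha k
  have h0 : a ≠ 0 := by simpa using ha 0
  have hk : a / 2 + k ≠ 0 := add_natCast_ne_zero ha k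
  have hk2 : a + 2 * k ≠ 0 := fun h2 => hk (by linear_combination h2 / 2)
  have hp : (1 + 2 * (k : ℂ) / a) * (a / 2 / (a / 2 + k)) = 1 := by
    field_simp
  rw [pochRatio_eq_div] at h
  rw [veryWellPoised, wellPoised, show 1 + a - a / 2 = a / 2 + 1 by ring]
  simp only [pochRatio_eq_div]
  rw [← h] at hp
  simp only [div_eq_mul_inv, mul_inv] at hp ⊢
  linear_combination (ascPochhammer ℂ k).eval a * (ascPochhammer ℂ k).eval b *
    (ascPochhammer ℂ k).eval c * ((ascPochhammer ℂ k).eval 1)⁻¹ *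
    ((ascPochhammer ℂ k).eval (1 + a - b))⁻¹ * ((ascPochhammer ℂ k).eval (1 + a - c))⁻¹ * hp

end Summation

end ContiguousDixon

theorem stmt5 (a b c : ℂ)
    (hre : 0 < ((1 + a) / 2 - b - c).re)
    (hab : ∀ m : ℕ, 1 + a - b ≠ -(m : ℂ))
    (hac : ∀ m : ℕ, a - c ≠ -(m : ℂ))
    (hG1 : ∀ m : ℕ, (1 + a) / 2 - b - c ≠ -(m : ℂ))
    (hG2 : ∀ m : ℕ, (a - c) / 2 ≠ -(m : ℂ))
    (hG3 : ∀ m : ℕ, (1 + a - c) / 2 ≠ -(m : ℂ))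
    (hG4 : ∀ m : ℕ, 1 + a - b - c ≠ -(m : ℂ))
    (hG5 : ∀ m : ℕ, a / 2 ≠ -(m : ℂ))
    (hG6 : ∀ m : ℕ, (1 + a) / 2 - b ≠ -(m : ℂ))
    (hG7 : ∀ m : ℕ, (1 + a) / 2 - c ≠ -(m : ℂ))
    (hG8 : ∀ m : ℕ, (2 + a) / 2 - b - c ≠ -(m : ℂ))
    (hG9 : ∀ m : ℕ, (1 + a) / 2 ≠ -(m : ℂ))
    (hG10 : ∀ m : ℕ, (2 + a) / 2 - b ≠ -(m : ℂ))
    (hG11 : ∀ m : ℕ, a / 2 - c ≠ -(m : ℂ)) :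
    ∑' k : ℕ,
        ((ascPochhammer ℂ k).eval a * (ascPochhammer ℂ k).eval b *
            (ascPochhammer ℂ k).eval c) /
          ((ascPochhammer ℂ k).eval 1 * (ascPochhammer ℂ k).eval (1 + a - b) *
            (ascPochhammer ℂ k).eval (a - c))
    = (2 : ℂ) ^ (-(1 + c)) *
        (Complex.Gamma (1 + a - b) * Complex.Gamma ((1 + a) / 2 - b - c) *
          Complex.Gamma ((a - c) / 2) * Complex.Gamma ((1 + a - c) / 2)) /
        (Complex.Gamma (1 + a - b - c) * Complex.Gamma (a / 2) *
          Complex.Gamma ((1 + a) / 2 - b) * Complex.Gamma ((1 + a) / 2 - c))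
    + (2 : ℂ) ^ (-(1 + c)) *
        (Complex.Gamma (1 + a - b) * Complex.Gamma ((2 + a) / 2 - b - c) *
          Complex.Gamma ((a - c) / 2) * Complex.Gamma ((1 + a - c) / 2)) /
        (Complex.Gamma (1 + a - b - c) * Complex.Gamma ((1 + a) / 2) *
          Complex.Gamma ((2 + a) / 2 - b) * Complex.Gamma (a / 2 - c)) := by
  have h2 : ∀ x : ℂ, (∀ m : ℕ, x / 2 ≠ -(m : ℂ)) → (∀ m : ℕ, (1 + x) / 2 ≠ -(m : ℂ)) →
      ∀ m : ℕ, x ≠ -(m : ℂ) := by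
    intro x hx hx' m hm
    rcases Nat.even_or_odd' m with ⟨r, rfl | rfl⟩
    · exact hx r (by rw [hm]; push_cast; ring)
    · exact hx' r (by rw [hm]; push_cast; ring)
  have ha := h2 a hG5 hG9
  have ha0 : a ≠ 0 := by simpa using ha 0
  have hac0 : a - c ≠ 0 := by simpa using hac 0
  have hac1 : ∀ m : ℕ, 1 + a - c ≠ -(m : ℂ) := fun m => by
    have := add_natCast_ne_neg hac 1 m
    rwa [show 1 + a - c = a - c + (1 : ℕ) by push_cast; ring]
  have ha1 : ∀ m : ℕ, 1 + a ≠ -(m : ℂ) := fun m => by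
    have := add_natCast_ne_neg ha 1 m
    rwa [show 1 + a = a + (1 : ℕ) by push_cast; ring]
  have hd1 : ∀ m : ℕ, 1 + a - (1 + a) / 2 ≠ -(m : ℂ) := by
    rwa [show 1 + a - (1 + a) / 2 = (1 + a) / 2 by ring]
  have hd2 : ∀ m : ℕ, 1 + a - a / 2 ≠ -(m : ℂ) := fun m => by
    have := add_natCast_ne_neg hG5 1 m
    rwa [show 1 + a - a / 2 = a / 2 + (1 : ℕ) by push_cast; ring]
  have hs1 : 0 < (1 + a - b - c - (1 + a) / 2).re := by
    rwa [show 1 + a - b - c - (1 + a) / 2 = (1 + a) / 2 - b - c by ring]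
  have hs2 : 0 < (1 + a - b - c - a / 2).re := by
    rw [show 1 + a - b - c - a / 2 = ((1 + a) / 2 - b - c) + (1 / 2 : ℝ) by push_cast; ring,
      Complex.add_re, Complex.ofReal_re]
    linarith
  have V := tsum_veryWellPoised hs1 ha hab hac1 hd1
  have D := tsum_veryWellPoised hs2 ha hab hac1 hd2
  have SV := summable_veryWellPoised hs1 hab hac1 hd1
  have SD := summable_veryWellPoised hs2 hab hac1 hd2
  have hterm : ∀ k : ℕ, ((ascPochhammer ℂ k).eval a * (ascPochhammer ℂ k).eval b *
        (ascPochhammer ℂ k).eval c) /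
      ((ascPochhammer ℂ k).eval 1 * (ascPochhammer ℂ k).eval (1 + a - b) *
        (ascPochhammer ℂ k).eval (a - c)) =
      a / 2 / (a - c) * veryWellPoised a b c ((1 + a) / 2) k +
        (a / 2 - c) / (a - c) * veryWellPoised a b c (a / 2) k := by
    intro k
    rw [veryWellPoised_one_add_div_two hG9, veryWellPoised_div_two hG5]
    have e := mul_ascPochhammer_eval_add_one (a - c) k
    rw [show a - c + 1 = 1 + a - c by ring] at e
    have n0 := ascPochhammer_eval_ne_zero hac k
    have n1 := ascPochhammer_eval_ne_zero hac1 k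
    have nb := ascPochhammer_eval_ne_zero hab k
    have no := ascPochhammer_eval_ne_zero one_ne_neg_natCast k
    have e' : ((ascPochhammer ℂ k).eval (a - c))⁻¹ =
        (a - c + k) / (a - c) * ((ascPochhammer ℂ k).eval (1 + a - c))⁻¹ := by
      field_simp
      linear_combination e
    rw [div_eq_mul_inv, mul_inv, e']
    field_simp
    ring
  rw [tsum_congr hterm, (SV.mul_left _).tsum_add (SD.mul_left _), tsum_mul_left, tsum_mul_left, V, D]
  have dupA := Complex.Gamma_mul_Gamma_add_half ((1 + a) / 2)
  have dupC := Complex.Gamma_mul_Gamma_add_half ((a - c) / 2)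
  rw [show (1 + a) / 2 + 1 / 2 = a / 2 + 1 by ring, show 2 * ((1 + a) / 2) = 1 + a by ring,
    Complex.Gamma_add_one _ (by simpa using hG5 0), show 1 - (1 + a) = -a by ring] at dupA
  rw [show (a - c) / 2 + 1 / 2 = (1 + a - c) / 2 by ring,
    show 2 * ((a - c) / 2) = a - c by ring] at dupC
  have hGc : Complex.Gamma (1 + a - c) = (a - c) * Complex.Gamma (a - c) := by
    rw [← Complex.Gamma_add_one _ hac0]
    congr 1
    ring
  have hGac : Complex.Gamma (1 + a / 2 - c) = (a / 2 - c) * Complex.Gamma (a / 2 - c) := by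
    rw [← Complex.Gamma_add_one _ (by simpa using hG11 0)]
    congr 1
    ring
  have hGa2 : Complex.Gamma (1 + a / 2) = a / 2 * Complex.Gamma (a / 2) := by
    rw [← Complex.Gamma_add_one _ (by simpa using hG5 0), add_comm]
  have hpow : (2 : ℂ) ^ (-(1 + c)) * (2 : ℂ) ^ (1 - (a - c)) = (2 : ℂ) ^ (-a) := by
    rw [← Complex.cpow_add _ _ two_ne_zero]
    congr 1
    ring
  have key : (2 : ℂ) ^ (-(1 + c)) * (Complex.Gamma ((a - c) / 2) * Complex.Gamma ((1 + a - c) / 2)) *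
      Complex.Gamma (1 + a) =
      Complex.Gamma (a - c) * (Complex.Gamma ((1 + a) / 2) * (a / 2 * Complex.Gamma (a / 2))) := by
    rw [dupA, dupC, ← hpow]
    ring
  have g1 := Complex.Gamma_ne_zero ha1
  have g4 := Complex.Gamma_ne_zero hG4
  have g5 := Complex.Gamma_ne_zero hG5
  have g6 := Complex.Gamma_ne_zero hG6
  have g7 := Complex.Gamma_ne_zero hG7
  have g9 := Complex.Gamma_ne_zero hG9
  have g10 := Complex.Gamma_ne_zero hG10
  have g11 := Complex.Gamma_ne_zero hG11
  have hc0 : a - 2 * c ≠ 0 := fun h => hG11 0 (by push_cast; linear_combination h / 2)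
  rw [show 1 + a - (1 + a) / 2 = (1 + a) / 2 by ring,
    show 1 + a - b - (1 + a) / 2 = (1 + a) / 2 - b by ring,
    show 1 + a - c - (1 + a) / 2 = (1 + a) / 2 - c by ring,
    show 1 + a - b - c - (1 + a) / 2 = (1 + a) / 2 - b - c by ring,
    show 1 + a - a / 2 = 1 + a / 2 by ring,
    show 1 + a - b - a / 2 = (2 + a) / 2 - b by ring,
    show 1 + a - c - a / 2 = 1 + a / 2 - c by ring,
    show 1 + a - b - c - a / 2 = (2 + a) / 2 - b - c by ring, hGc, hGac, hGa2]
  have key' : (2 : ℂ) ^ (-(1 + c)) *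
      (Complex.Gamma ((a - c) / 2) * Complex.Gamma ((1 + a - c) / 2)) =
      Complex.Gamma (a - c) * (Complex.Gamma ((1 + a) / 2) * (a / 2 * Complex.Gamma (a / 2))) /
        Complex.Gamma (1 + a) := by
    rw [eq_div_iff g1, key]
  congr 1
  · calc _ = (Complex.Gamma (a - c) * (Complex.Gamma ((1 + a) / 2) *
          (a / 2 * Complex.Gamma (a / 2))) / Complex.Gamma (1 + a)) *
          (Complex.Gamma (1 + a - b) * Complex.Gamma ((1 + a) / 2 - b - c)) /
        (Complex.Gamma (1 + a - b - c) * Complex.Gamma (a / 2) *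
          Complex.Gamma ((1 + a) / 2 - b) * Complex.Gamma ((1 + a) / 2 - c)) := by field_simp
      _ = _ := by rw [← key']; ring
  · calc _ = (Complex.Gamma (a - c) * (Complex.Gamma ((1 + a) / 2) *
          (a / 2 * Complex.Gamma (a / 2))) / Complex.Gamma (1 + a)) *
          (Complex.Gamma (1 + a - b) * Complex.Gamma ((2 + a) / 2 - b - c)) /
        (Complex.Gamma (1 + a - b - c) * Complex.Gamma ((1 + a) / 2) *
          Complex.Gamma ((2 + a) / 2 - b) * Complex.Gamma (a / 2 - c)) := by field_simp
      _ = _ := by rw [← key']; ring
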